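/- Let |G⟩ be a graph state on n ≥ 3 qubits with stabilizer S. If S contains two distinct commuting elements of weight 2 that act nontrivially on the same pair of qubits {a,b}, then |G⟩ factorizes as a tensor product |G⟩ = |ψ_B⟩ ⊗ |ψ̃⟩ of a two-qubit state |ψ_B⟩ on qubits {a,b} (locally unitarily equivalent to a Bell state, with stabilizer {I, X⊗X, Z⊗Z, −Y⊗Y} up to local unitaries) and a state |ψ̃⟩ on the remaining n−2 qubits; in particular |G⟩ is not fully entangled, i.e., the graph G is disconnected. -/

import Mathlib

open Matrix BigOperators
open scoped Classical

noncomputable section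

/-- The state space of `n` qubits, `(ℂ²)^{⊗n}`, realized as functions from bit strings to `ℂ`. -/
abbrev QState (n : ℕ) : Type := (Fin n → Fin 2) → ℂ

/-- Operators on `n` qubits. -/
abbrev QOp (n : ℕ) : Type := Matrix (Fin n → Fin 2) (Fin n → Fin 2) ℂ

/-- The single qubit Pauli matrices: `0 ↦ σ₀ = I`, `1 ↦ σ_x`, `2 ↦ σ_y`, `3 ↦ σ_z`. -/
def pauli1 (k : Fin 4) : Matrix (Fin 2) (Fin 2) ℂ :=
  if k = 0 then 1
  else if k = 1 then !![0, 1; 1, 0]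
  else if k = 2 then !![0, -Complex.I; Complex.I, 0]
  else !![1, 0; 0, -1]

/-- The `n`-qubit Pauli operator `σ_{f 0} ⊗ σ_{f 1} ⊗ ⋯ ⊗ σ_{f (n-1)}`. -/
def pauliOp {n : ℕ} (f : Fin n → Fin 4) : QOp n :=
  Matrix.of fun v w => ∏ i, pauli1 (f i) (v i) (w i)

/-- The support of a Pauli operator: the qubits on which it acts nontrivially. -/
def pSupport {n : ℕ} (f : Fin n → Fin 4) : Finset (Fin n) :=
  Finset.univ.filter fun i => f i ≠ 0

/-- The weight of a Pauli operator: the number of qubits on which it acts nontrivially. -/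
def pWeight {n : ℕ} (f : Fin n → Fin 4) : ℕ := (pSupport f).card

/-- `g` is the signed Pauli operator `±σ_f`. -/
def IsSignedPauli {n : ℕ} (g : QOp n) (f : Fin n → Fin 4) : Prop :=
  g = pauliOp f ∨ g = -pauliOp f

/-- The squared norm `∑_v |ψ_v|²` of an `n`-qubit state. -/
def qNormSq {n : ℕ} (ψ : QState n) : ℝ := ∑ v, Complex.normSq (ψ v)

/-- The inner product `⟨φ|ψ⟩` (antilinear in the first argument). -/
def qInner {n : ℕ} (φ ψ : QState n) : ℂ := ∑ v, starRingEnd ℂ (φ v) * ψ v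

/-- The graph state correlation operator `K_a = σ_x^(a) ∏_{b ∈ N(a)} σ_z^(b)`. -/
def Kop {n : ℕ} (G : SimpleGraph (Fin n)) [DecidableRel G.Adj] (a : Fin n) : QOp n :=
  pauliOp fun b => if b = a then 1 else if G.Adj a b then 3 else 0

/-- `ψ` is the graph state `|G⟩`: a unit vector fixed by all correlation operators `K_a`. -/
def IsGraphState {n : ℕ} (G : SimpleGraph (Fin n)) [DecidableRel G.Adj] (ψ : QState n) : Prop :=
  qNormSq ψ = 1 ∧ ∀ a : Fin n, Kop G a *ᵥ ψ = ψ

/-- The stabilizer of `ψ`: all signed Pauli operators `g = ±σ` with `g ψ = ψ`. -/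
def stab {n : ℕ} (ψ : QState n) : Set (QOp n) :=
  {g | (∃ f, IsSignedPauli g f) ∧ g *ᵥ ψ = ψ}

/-- The stabilizer elements of weight at most `d`. -/
def stabW {n : ℕ} (ψ : QState n) (d : ℕ) : Set (QOp n) :=
  {g | g ∈ stab ψ ∧ ∃ f, IsSignedPauli g f ∧ pWeight f ≤ d}

/-- `S_d`: the subgroup of the stabilizer generated by all elements of weight at most `d`,
as a set of operators.  (Since the stabilizer is a finite group, the generated submonoid
coincides with the generated subgroup.) -/
def SdSet {n : ℕ} (ψ : QState n) (d : ℕ) : Set (QOp n) :=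
  (Submonoid.closure (stabW ψ d) : Set (QOp n))

/-- `δ(|ψ⟩)`: the minimal weight of a nonidentity element of the stabilizer of `ψ`. -/
def deltaG {n : ℕ} (ψ : QState n) : ℕ :=
  sInf {d | ∃ g ∈ stab ψ, g ≠ 1 ∧ ∃ f, IsSignedPauli g f ∧ pWeight f = d}

/-- `η(|ψ⟩)`: the minimal `d` such that `S_d = S`. -/
def etaG {n : ℕ} (ψ : QState n) : ℕ :=
  sInf {d | stab ψ ⊆ SdSet ψ d}

/-- A `d`-body Hamiltonian on `n` qubits: a real linear combination of Pauli operators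
of weight at most `d`. -/
def IsDBody {n : ℕ} (d : ℕ) (H : QOp n) : Prop :=
  ∃ h : (Fin n → Fin 4) → ℝ, (∀ f, d < pWeight f → h f = 0) ∧
    H = ∑ f : Fin n → Fin 4, (h f : ℂ) • pauliOp f

/-- A Hamiltonian is nontrivial if it is nonzero and not a multiple of the identity. -/
def NontrivialHam {n : ℕ} (H : QOp n) : Prop :=
  H ≠ 0 ∧ ∀ c : ℂ, H ≠ c • (1 : QOp n)

/-- `φ` is an eigenvector of `H` with (real) eigenvalue `E`. -/
def IsEigenpair {n : ℕ} (H : QOp n) (E : ℝ) (φ : QState n) : Prop :=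
  φ ≠ 0 ∧ H *ᵥ φ = (E : ℂ) • φ

/-- `ψ` is a ground state of `H` with ground energy `E`: an eigenvector for the smallest
eigenvalue `E` of `H`. -/
def IsGroundStateE {n : ℕ} (H : QOp n) (ψ : QState n) (E : ℝ) : Prop :=
  IsEigenpair H E ψ ∧ ∀ E' φ, IsEigenpair H E' φ → E ≤ E'

/-- `ψ` is a ground state of `H`. -/
def IsGroundState {n : ℕ} (H : QOp n) (ψ : QState n) : Prop :=
  ∃ E, IsGroundStateE H ψ E

/-- The dimension of the eigenspace of `H` for the eigenvalue `E` (the multiplicity of `E`). -/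
def eigDim {n : ℕ} (H : QOp n) (E : ℝ) : ℕ :=
  Module.finrank ℂ (Module.End.eigenspace (Matrix.mulVecLin H) ((E : ℂ)))


lemma pauli1_mul_self (k : Fin 4) : pauli1 k * pauli1 k = 1 := by
  fin_cases k <;> ext i j <;> fin_cases i <;> fin_cases j <;>
    simp [pauli1, Matrix.mul_apply, Fin.sum_univ_two]

lemma pauli1_conjTranspose (k : Fin 4) : (pauli1 k)ᴴ = pauli1 k := by
  fin_cases k <;> ext i j <;> fin_cases i <;> fin_cases j <;>
    simp [pauli1, Matrix.conjTranspose_apply]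

lemma pauli1_mul_eq_neg {p q : Fin 4} (hp : p ≠ 0) (hq : q ≠ 0) (hpq : p ≠ q) :
    pauli1 p * pauli1 q = -(pauli1 q * pauli1 p) := by
  fin_cases p <;> fin_cases q <;> first | contradiction | skip
  all_goals
    ext i j
    fin_cases i <;> fin_cases j <;> simp [pauli1, Matrix.mul_apply, Fin.sum_univ_two]

/-- A matrix commuting with two distinct nontrivial Pauli matrices is scalar. -/
lemma eq_smul_one_of_commute_pauli1 {p q : Fin 4} (hp : p ≠ 0) (hq : q ≠ 0) (hpq : p ≠ q)
    {N : Matrix (Fin 2) (Fin 2) ℂ} (h₁ : pauli1 p * N = N * pauli1 p)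
    (h₂ : pauli1 q * N = N * pauli1 q) : N = N 0 0 • (1 : Matrix (Fin 2) (Fin 2) ℂ) := by
  have hI := Complex.I_ne_zero
  have a00 := congrFun (congrFun h₁ 0) 0
  have a01 := congrFun (congrFun h₁ 0) 1
  have b00 := congrFun (congrFun h₂ 0) 0
  have b01 := congrFun (congrFun h₂ 0) 1
  have key : N 0 1 = 0 ∧ N 1 0 = 0 ∧ N 1 1 = N 0 0 := by
    clear h₁ h₂
    fin_cases p <;> fin_cases q <;> first | contradiction | skip
    all_goals
      simp [pauli1, Matrix.mul_apply, Fin.sum_univ_two] at a00 a01 b00 b01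
      grind
  ext i j
  fin_cases i <;> fin_cases j <;> simp [key]

/-- The invariance `M = ε A M Bᵀ` passes to `M Nᴴ` as commutation with `A`. -/
lemma pauli1_commute_mul_conjTranspose {p q : Fin 4} {ε : ℂ} (hε : ε * star ε = 1)
    {M N : Matrix (Fin 2) (Fin 2) ℂ}
    (hM : M = ε • (pauli1 p * M * (pauli1 q)ᵀ)) (hN : N = ε • (pauli1 p * N * (pauli1 q)ᵀ)) :
    pauli1 p * (M * Nᴴ) = M * Nᴴ * pauli1 p := by
  have hq : (pauli1 q)ᵀ * ((pauli1 q)ᵀ)ᴴ = 1 := by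
    rw [← Matrix.transpose_one, ← pauli1_mul_self q, Matrix.transpose_mul,
      show ((pauli1 q)ᵀ)ᴴ = ((pauli1 q)ᴴ)ᵀ from rfl, pauli1_conjTranspose]
  have key : M * Nᴴ = pauli1 p * (M * Nᴴ) * pauli1 p := by
    calc M * Nᴴ = (ε • (pauli1 p * M * (pauli1 q)ᵀ)) * (ε • (pauli1 p * N * (pauli1 q)ᵀ))ᴴ := by
          rw [← hM, ← hN]
      _ = (ε * star ε) • (pauli1 p * M * ((pauli1 q)ᵀ * ((pauli1 q)ᵀ)ᴴ) * Nᴴ * pauli1 p) := by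
          simp only [Matrix.conjTranspose_smul, Matrix.conjTranspose_mul, pauli1_conjTranspose,
            Matrix.smul_mul, Matrix.mul_smul, smul_smul, Matrix.mul_assoc]
          rw [mul_comm]
      _ = pauli1 p * (M * Nᴴ) * pauli1 p := by
          rw [hε, hq]; simp [Matrix.mul_assoc]
  conv_rhs => rw [key]
  rw [Matrix.mul_assoc, Matrix.mul_assoc, pauli1_mul_self, Matrix.mul_one]

open scoped ComplexOrder in
/-- A nonzero solution of the two invariance equations is invertible and spans all solutions. -/
lemma eq_smul_of_two_pauli1_invariances {p q r s : Fin 4} (hp : p ≠ 0) (hr : r ≠ 0)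
    (hpr : p ≠ r) {ε δ : ℂ} (hε : ε * star ε = 1) (hδ : δ * star δ = 1)
    {N : Matrix (Fin 2) (Fin 2) ℂ} (hN0 : N ≠ 0)
    (hN₁ : N = ε • (pauli1 p * N * (pauli1 q)ᵀ)) (hN₂ : N = δ • (pauli1 r * N * (pauli1 s)ᵀ)) :
    N.det ≠ 0 ∧ ∀ M : Matrix (Fin 2) (Fin 2) ℂ, M = ε • (pauli1 p * M * (pauli1 q)ᵀ) →
      M = δ • (pauli1 r * M * (pauli1 s)ᵀ) → ∃ c : ℂ, M = c • N := by
  have scalar : ∀ M : Matrix (Fin 2) (Fin 2) ℂ, M = ε • (pauli1 p * M * (pauli1 q)ᵀ) →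
      M = δ • (pauli1 r * M * (pauli1 s)ᵀ) →
      ∃ c : ℂ, M * Nᴴ = c • (1 : Matrix (Fin 2) (Fin 2) ℂ) := fun M h₁ h₂ =>
    ⟨_, eq_smul_one_of_commute_pauli1 hp hr hpr (pauli1_commute_mul_conjTranspose hε h₁ hN₁)
      (pauli1_commute_mul_conjTranspose hδ h₂ hN₂)⟩
  obtain ⟨c₀, hc₀⟩ := scalar N hN₁ hN₂
  have hc₀' : c₀ ≠ 0 := by
    rintro rfl
    exact hN0 (Matrix.self_mul_conjTranspose_eq_zero.1 (by simpa using hc₀))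
  have hinv : N * (c₀⁻¹ • Nᴴ) = 1 := by
    rw [Matrix.mul_smul, hc₀, smul_smul, inv_mul_cancel₀ hc₀', one_smul]
  refine ⟨fun hdet => ?_, fun M h₁ h₂ => ?_⟩
  · simpa [hdet] using congrArg Matrix.det hinv
  · obtain ⟨c, hc⟩ := scalar M h₁ h₂
    refine ⟨c₀⁻¹ * c, ?_⟩
    calc M = M * ((c₀⁻¹ • Nᴴ) * N) := by rw [mul_eq_one_comm.1 hinv, Matrix.mul_one]
      _ = (c₀⁻¹ * c) • N := by
        rw [← Matrix.mul_assoc, Matrix.mul_smul, hc, smul_smul, Matrix.smul_mul, Matrix.one_mul]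

lemma eq_zero_of_pauli1_invariances_same_left {p q s : Fin 4} (hq : q ≠ 0) (hs : s ≠ 0)
    (hqs : q ≠ s) {ε δ : ℂ} {M : Matrix (Fin 2) (Fin 2) ℂ}
    (h₁ : M = ε • (pauli1 p * M * (pauli1 q)ᵀ)) (h₂ : M = δ • (pauli1 p * M * (pauli1 s)ᵀ)) :
    M = 0 := by
  have e₁ : M = (ε * δ) • (M * (pauli1 q * pauli1 s)ᵀ) := by
    conv_lhs => rw [h₁, h₂]
    simp only [Matrix.mul_smul, Matrix.smul_mul, smul_smul, Matrix.transpose_mul]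
    simp only [← Matrix.mul_assoc, pauli1_mul_self, Matrix.one_mul]
  have e₂ : M = (ε * δ) • (M * (pauli1 s * pauli1 q)ᵀ) := by
    conv_lhs => rw [h₂, h₁]
    simp only [Matrix.mul_smul, Matrix.smul_mul, smul_smul, Matrix.transpose_mul]
    simp only [← Matrix.mul_assoc, pauli1_mul_self, Matrix.one_mul, mul_comm δ ε]
  rw [pauli1_mul_eq_neg hq hs hqs, Matrix.transpose_neg, Matrix.mul_neg, smul_neg, ← e₂] at e₁
  ext i j
  exact self_eq_neg.1 (congrFun (congrFun e₁ i) j)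

/-- The two-qubit slice of `ψ` at qubits `a, b`, the other qubits being set as in `v`. -/
def twoQubitSlice {n : ℕ} (ψ : QState n) (a b : Fin n) (v : Fin n → Fin 2) :
    Matrix (Fin 2) (Fin 2) ℂ :=
  Matrix.of fun x y => ψ (Function.update (Function.update v a x) b y)

lemma twoQubitSlice_self {n : ℕ} (ψ : QState n) (a b : Fin n) (v : Fin n → Fin 2) :
    twoQubitSlice ψ a b v (v a) (v b) = ψ v := by
  simp [twoQubitSlice]

lemma twoQubitSlice_congr {n : ℕ} (ψ : QState n) {a b : Fin n} {v w : Fin n → Fin 2}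
    (h : ∀ c, c ≠ a → c ≠ b → v c = w c) : twoQubitSlice ψ a b v = twoQubitSlice ψ a b w := by
  ext x y
  simp only [twoQubitSlice, Matrix.of_apply]
  congr 1
  ext c
  by_cases hb : c = b
  · simp [hb]
  · by_cases ha : c = a
    · simp [Function.update_apply, ha]
    · simp [hb, ha, h c ha hb]

lemma pauli1_zero_apply (x y : Fin 2) : pauli1 0 x y = if x = y then 1 else 0 := by
  simp [pauli1, Matrix.one_apply]

lemma twoQubitSlice_pauliOp_mulVec {n : ℕ} (ψ : QState n) {a b : Fin n} (hab : a ≠ b)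
    {f : Fin n → Fin 4} (hf : pSupport f = {a, b}) (v : Fin n → Fin 2) :
    twoQubitSlice (pauliOp f *ᵥ ψ) a b v =
      pauli1 (f a) * twoQubitSlice ψ a b v * (pauli1 (f b))ᵀ := by
  have hf0 : ∀ c, c ≠ a → c ≠ b → f c = 0 := by
    intro c ha hb
    by_contra h
    have : c ∈ pSupport f := by simp [pSupport, h]
    simp [hf, ha, hb] at this
  ext x y
  let u : Fin 2 × Fin 2 → Fin n → Fin 2 := fun z =>
    Function.update (Function.update v a z.1) b z.2
  have ua : ∀ z, u z a = z.1 := fun z => by simp [u, hab]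
  have ub : ∀ z, u z b = z.2 := fun z => by simp [u]
  have uc : ∀ z c, c ≠ a → c ≠ b → u z c = v c := fun z c ha hb => by
    simp [u, ha, hb]
  have huinj : Function.Injective u := fun z z' h =>
    Prod.ext (by rw [← ua z, h, ua]) (by rw [← ub z, h, ub])
  have hsum : (pauliOp f *ᵥ ψ) (u (x, y)) =
      ∑ z : Fin 2 × Fin 2, pauli1 (f a) x z.1 * pauli1 (f b) y z.2 * ψ (u z) := by
    simp only [Matrix.mulVec, dotProduct]
    symm
    refine Fintype.sum_of_injective u huinj _ _ ?_ ?_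
    · intro w hw
      have : ∃ c, c ≠ a ∧ c ≠ b ∧ v c ≠ w c := by
        by_contra! h
        refine hw ⟨(w a, w b), ?_⟩
        ext c
        by_cases ha : c = a
        · rw [ha, ua]
        · by_cases hb : c = b
          · rw [hb, ub]
          · rw [uc _ c ha hb, h c ha hb]
      obtain ⟨c, ha, hb, hc⟩ := this
      have : pauliOp f (u (x, y)) w = 0 := by
        simp only [pauliOp, Matrix.of_apply]
        refine Finset.prod_eq_zero (Finset.mem_univ c) ?_
        rw [hf0 c ha hb, pauli1_zero_apply, uc _ c ha hb, if_neg hc]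
      rw [this, zero_mul]
    · intro z
      congr 1
      simp only [pauliOp, Matrix.of_apply]
      rw [Fintype.prod_eq_mul a b hab]
      · rw [ua, ub, ua, ub]
      · rintro c ⟨ha, hb⟩
        rw [hf0 c ha hb, pauli1_zero_apply, uc _ c ha hb, uc _ c ha hb, if_pos rfl]
  change (pauliOp f *ᵥ ψ) (u (x, y)) = _
  rw [hsum, Fintype.sum_prod_type]
  simp only [Matrix.mul_apply, Fin.sum_univ_two, Matrix.transpose_apply, twoQubitSlice,
    Matrix.of_apply, u]
  ring

/-- A stabilizer element supported on `{a, b}` imposes an invariance on every slice. -/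
lemma exists_sign_twoQubitSlice_invariant {n : ℕ} {ψ : QState n} {a b : Fin n} (hab : a ≠ b)
    {g : QOp n} {f : Fin n → Fin 4} (hg : g ∈ stab ψ) (hp : IsSignedPauli g f)
    (hs : pSupport f = {a, b}) :
    ∃ ε : ℂ, ε * star ε = 1 ∧ g = ε • pauliOp f ∧ ∀ v, twoQubitSlice ψ a b v =
      ε • (pauli1 (f a) * twoQubitSlice ψ a b v * (pauli1 (f b))ᵀ) := by
  have hε : ∃ ε : ℂ, ε * star ε = 1 ∧ g = ε • pauliOp f := by
    rcases hp with h | h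
    · exact ⟨1, by simp, by simp [h]⟩
    · exact ⟨-1, by simp, by simp [h]⟩
  obtain ⟨ε, hε, rfl⟩ := hε
  refine ⟨ε, hε, rfl, fun v => ?_⟩
  rw [← twoQubitSlice_pauliOp_mulVec ψ hab hs]
  conv_lhs => rw [← hg.2, Matrix.smul_mulVec]
  rfl

lemma exists_ne_zero_of_qNormSq {n : ℕ} {ψ : QState n} (h : qNormSq ψ = 1) : ∃ v, ψ v ≠ 0 := by
  by_contra! h0
  simp [qNormSq, h0] at h

/-- The amplitudes of a graph state at bit strings differing at `c` agree up to a sign. -/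
lemma IsGraphState.apply_eq {n : ℕ} {G : SimpleGraph (Fin n)} [DecidableRel G.Adj]
    {ψ : QState n} (hψ : IsGraphState G ψ) (c : Fin n) (v : Fin n → Fin 2) :
    ψ v = (∏ i, if G.Adj c i ∧ v i = 1 then (-1 : ℂ) else 1) *
      ψ (Function.update v c (1 - v c)) := by
  have z3 : ∀ x y : Fin 2, pauli1 3 x y = if x = y then (if x = 1 then -1 else 1) else 0 := by
    intro x y
    fin_cases x <;> fin_cases y <;> simp [pauli1]
  have x1 : ∀ x y : Fin 2, pauli1 1 x y = if y = 1 - x then 1 else 0 := by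
    intro x y
    fin_cases x <;> fin_cases y <;> simp [pauli1]
  conv_lhs => rw [← hψ.2 c]
  simp only [Matrix.mulVec, dotProduct]
  rw [Fintype.sum_eq_single (Function.update v c (1 - v c))]
  · congr 1
    simp only [Kop, pauliOp, Matrix.of_apply]
    refine Finset.prod_congr rfl fun i _ => ?_
    by_cases hi : i = c
    · subst hi
      simp [x1]
    · by_cases hA : G.Adj c i <;> simp [hi, hA, z3, pauli1_zero_apply]
  · intro w hw
    have : ∃ i, w i ≠ Function.update v c (1 - v c) i := by
      by_contra! h
      exact hw (funext h)
    obtain ⟨i, hi⟩ := this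
    have : Kop G c v w = 0 := by
      simp only [Kop, pauliOp, Matrix.of_apply]
      refine Finset.prod_eq_zero (Finset.mem_univ i) ?_
      by_cases hic : i = c
      · subst hic
        simp only [Function.update_self] at hi
        simp [x1, hi]
      · simp only [Function.update_of_ne hic] at hi
        by_cases hA : G.Adj c i <;> simp [hic, hA, z3, pauli1_zero_apply, hi.symm]
    rw [this, zero_mul]

lemma IsGraphState.apply_ne_zero {n : ℕ} {G : SimpleGraph (Fin n)} [DecidableRel G.Adj]
    {ψ : QState n} (hψ : IsGraphState G ψ) (v : Fin n → Fin 2) : ψ v ≠ 0 := by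
  obtain ⟨v₀, hv₀⟩ := exists_ne_zero_of_qNormSq hψ.1
  have step : ∀ w c x, ψ w ≠ 0 → ψ (Function.update w c x) ≠ 0 := by
    intro w c x hw
    have hx : x = w c ∨ x = 1 - w c := by omega
    rcases hx with rfl | rfl
    · simpa using hw
    · exact right_ne_zero_of_mul (hψ.apply_eq c w ▸ hw)
  have key : ∀ s : Finset (Fin n), ψ (s.piecewise v v₀) ≠ 0 := by
    intro s
    induction s using Finset.induction_on with
    | empty => simpa using hv₀
    | insert j s _ ih =>
      rw [Finset.piecewise_insert]
      exact step _ _ _ ih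
  simpa using key Finset.univ

/-- If a graph state factorizes with respect to `{a, b}`, no edge leaves `{a, b}`. -/
lemma IsGraphState.not_adj_of_factorization {n : ℕ} {G : SimpleGraph (Fin n)}
    [DecidableRel G.Adj] {ψ : QState n} (hψ : IsGraphState G ψ) {a b c e : Fin n}
    (he : e = a ∨ e = b) (hca : c ≠ a) (hcb : c ≠ b) {ψB : Fin 2 → Fin 2 → ℂ}
    {ψr : ({c : Fin n // c ≠ a ∧ c ≠ b} → Fin 2) → ℂ}
    (h : ∀ v : Fin n → Fin 2, ψ v = ψB (v a) (v b) * ψr (fun c => v c.val)) :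
    ¬ G.Adj e c := by
  intro hadj
  have hce : c ≠ e := hadj.ne'
  let v : Fin n → Fin 2 := 0
  let v' : Fin n → Fin 2 := Function.update v e 1
  have h₁ : ψ v = ψ (Function.update v c 1) := by
    simpa [v] using hψ.apply_eq c v
  have h₂ : ψ v' = -ψ (Function.update v' c 1) := by
    have := hψ.apply_eq c v'
    rw [Fintype.prod_eq_single e] at this
    · simpa [v', v, hadj.symm, hce] using this
    · intro i hi
      simp [v', v, hi]
  have rest : ∀ x y : Fin n → Fin 2, (∀ i, i ≠ e → x i = y i) →
      (fun c : {c : Fin n // c ≠ a ∧ c ≠ b} => x c.val) = fun c => y c.val := by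
    intro x y hxy
    funext i
    refine hxy _ ?_
    rcases he with rfl | rfl
    · exact i.2.1
    · exact i.2.2
  have r₁ := rest v' v fun i hi => by simp [v', hi]
  have r₂ := rest (Function.update v' c 1) (Function.update v c 1) fun i hi => by
    simp [v', Function.update_apply, hi]
  have n₁ := hψ.apply_ne_zero v
  have n₂ := hψ.apply_ne_zero v'
  rw [h] at n₁ n₂
  rw [h v, h (Function.update v c 1)] at h₁
  rw [h v', h (Function.update v' c 1)] at h₂
  simp only [Function.update_of_ne hca.symm, Function.update_of_ne hcb.symm] at h₁ h₂
  rw [r₁, r₂, ← mul_neg] at h₂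
  have e₁ := mul_left_cancel₀ (left_ne_zero_of_mul n₁) h₁
  have e₂ := mul_left_cancel₀ (left_ne_zero_of_mul n₂) h₂
  rw [← e₁] at e₂
  exact right_ne_zero_of_mul n₁ (self_eq_neg.1 e₂)

/-- if the stabilizer of a graph state `|G⟩` on `n ≥ 3` qubits contains two
distinct commuting weight-2 elements acting nontrivially on the same pair of qubits `{a,b}`,
then `|G⟩` factorizes as `|ψ_B⟩ ⊗ |ψ̃⟩` with `|ψ_B⟩` an entangled (Bell-type) two-qubit state
on qubits `a, b` and `|ψ̃⟩` a state of the remaining `n - 2` qubits; in particular `|G⟩` is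
not fully entangled, i.e. the graph `G` is disconnected. -/
theorem shared_support_weight_two_stabilizers_force_factorization
    {n : ℕ} (hn : 3 ≤ n) (G : SimpleGraph (Fin n)) [DecidableRel G.Adj]
    (ψ : QState n) (hψ : IsGraphState G ψ)
    (a b : Fin n) (hab : a ≠ b)
    (g₁ g₂ : QOp n) (f₁ f₂ : Fin n → Fin 4)
    (hg₁ : g₁ ∈ stab ψ) (hg₂ : g₂ ∈ stab ψ) (hne : g₁ ≠ g₂)
    (hcomm : g₁ * g₂ = g₂ * g₁)
    (hp₁ : IsSignedPauli g₁ f₁) (hp₂ : IsSignedPauli g₂ f₂)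
    (hs₁ : pSupport f₁ = {a, b}) (hs₂ : pSupport f₂ = {a, b}) :
    (∃ (ψB : Fin 2 → Fin 2 → ℂ) (ψr : ({c : Fin n // c ≠ a ∧ c ≠ b} → Fin 2) → ℂ),
        (¬ ∃ u w : Fin 2 → ℂ, ∀ x y, ψB x y = u x * w y) ∧
        ∀ v : Fin n → Fin 2, ψ v = ψB (v a) (v b) * ψr (fun c => v c.val)) ∧
    ¬ G.Connected := by
  have hsupp : ∀ {f : Fin n → Fin 4}, pSupport f = {a, b} → ∀ c, f c ≠ 0 ↔ c = a ∨ c = b := by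
    intro f hf c
    have := Finset.ext_iff.1 hf c
    simpa [pSupport] using this
  have hf₁ := hsupp hs₁
  have hf₂ := hsupp hs₂
  obtain ⟨ε, hε, hgε, inv₁⟩ := exists_sign_twoQubitSlice_invariant hab hg₁ hp₁ hs₁
  obtain ⟨δ, hδ, hgδ, inv₂⟩ := exists_sign_twoQubitSlice_invariant hab hg₂ hp₂ hs₂
  let N := twoQubitSlice ψ a b 0
  have hN0 : N ≠ 0 := by
    intro h
    have := twoQubitSlice_self ψ a b 0
    rw [show twoQubitSlice ψ a b 0 = 0 from h] at this
    exact hψ.apply_ne_zero 0 this.symm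
  have hfa : f₁ a ≠ f₂ a := by
    intro ha
    have hb : f₁ b = f₂ b := by
      by_contra hb
      have i₂ := inv₂ 0
      rw [← ha] at i₂
      exact hN0 (eq_zero_of_pauli1_invariances_same_left ((hf₁ b).2 (Or.inr rfl))
        ((hf₂ b).2 (Or.inr rfl)) hb (inv₁ 0) i₂)
    have hf : f₁ = f₂ := by
      funext c
      by_cases hc : c = a ∨ c = b
      · rcases hc with rfl | rfl
        · exact ha
        · exact hb
      · rw [not_not.1 (mt (hf₁ c).1 hc), not_not.1 (mt (hf₂ c).1 hc)]
    have hεδ : ε = δ := by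
      have h := (inv₁ 0).symm.trans (inv₂ 0)
      rw [hf] at h
      refine smul_left_injective ℂ (fun h0 => hN0 ?_) h
      rw [show N = _ from inv₂ 0, h0, smul_zero]
    exact hne (by rw [hgε, hgδ, hf, hεδ])
  obtain ⟨hdet, hspan⟩ := eq_smul_of_two_pauli1_invariances ((hf₁ a).2 (Or.inl rfl))
    ((hf₂ a).2 (Or.inl rfl)) hfa hε hδ hN0 (inv₁ 0) (inv₂ 0)
  choose c hc using fun v => hspan (twoQubitSlice ψ a b v) (inv₁ v) (inv₂ v)
  have hfact : ∃ (ψB : Fin 2 → Fin 2 → ℂ) (ψr : ({c : Fin n // c ≠ a ∧ c ≠ b} → Fin 2) → ℂ),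
      (¬ ∃ u w : Fin 2 → ℂ, ∀ x y, ψB x y = u x * w y) ∧
      ∀ v : Fin n → Fin 2, ψ v = ψB (v a) (v b) * ψr (fun c => v c.val) := by
    refine ⟨N, fun r => c fun i => if h : i ≠ a ∧ i ≠ b then r ⟨i, h⟩ else 0, ?_, fun v => ?_⟩
    · rintro ⟨u, w, huw⟩
      apply hdet
      rw [Matrix.det_fin_two, huw, huw, huw, huw]
      ring
    · rw [← twoQubitSlice_self ψ a b v, twoQubitSlice_congr ψ
        (w := fun i => if i ≠ a ∧ i ≠ b then v i else 0) fun i ha hb => by simp [ha, hb], hc]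
      simp [N, mul_comm]
  refine ⟨hfact, fun hconn => ?_⟩
  obtain ⟨ψB, ψr, -, h⟩ := hfact
  obtain ⟨d, hd⟩ : ∃ d, d ∉ ({a, b} : Finset (Fin n)) := by
    by_contra! hall
    have h₁ := Finset.card_le_card (fun x _ => hall x : Finset.univ ⊆ ({a, b} : Finset (Fin n)))
    have h₂ := Finset.card_le_two (a := a) (b := b)
    rw [Finset.card_univ, Fintype.card_fin] at h₁
    omega
  obtain ⟨p⟩ := hconn.preconnected a d
  obtain ⟨e, -, he₁, he₂⟩ := p.exists_boundary_dart {a, b} (by simp) (by simpa using hd)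
  simp only [Set.mem_insert_iff, Set.mem_singleton_iff, not_or] at he₁ he₂
  exact hψ.not_adj_of_factorization he₁ he₂.1 he₂.2 h e.adj
end
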